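/- Let λ ∈ ℝ^n, let x ∈ {0,1}^n be a codeword of C(G), and suppose x is (T,w)-locally optimal for λ: for every minimal T-local deviation β, ⟨λ, x ⊕ β^{(w)}⟩ > ⟨λ, x⟩, where T < girth(G)/4 and w ∈ [0,1]^T. Assume the codeword decomposition lemma: for every nonzero codeword z of C(G) there is a distribution over minimal T-local deviations β and some α ∈ (0,1] with E[β^{(w)}] = α·z. Then x is the unique maximum-likelihood codeword, i.e., ⟨λ, x'⟩ > ⟨λ, x⟩ for every codeword x' ≠ x. -/

import Mathlib

theorem abs_sub_eq_add_of_binary {a b : ℝ} (ha : a = 0 ∨ a = 1) (hb : b ∈ Set.Icc (0 : ℝ) 1) :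
    |a - b| = a + (1 - 2 * a) * b := by
  obtain ⟨h0, h1⟩ := hb
  rcases ha with rfl | rfl
  · rw [zero_sub, abs_neg, abs_of_nonneg h0]; ring
  · rw [abs_of_nonneg (by linarith)]; ring

/-- The cost increase from a binary point to a relative point is linear in the deviation. -/
theorem sum_mul_abs_sub_of_binary {ι : Type*} [Fintype ι] (lam : ι → ℝ) {x b : ι → ℝ}
    (hx : ∀ i, x i = 0 ∨ x i = 1) (hb : ∀ i, b i ∈ Set.Icc (0 : ℝ) 1) :
    ∑ i, lam i * |x i - b i| = ∑ i, lam i * x i + ∑ i, lam i * (1 - 2 * x i) * b i := by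
  rw [← Finset.sum_add_distrib]
  refine Finset.sum_congr rfl fun i _ => ?_
  rw [abs_sub_eq_add_of_binary (hx i) (hb i)]
  ring

theorem sum_mul_pos_of_sum_eq_one {ι : Type*} [Fintype ι] {p f : ι → ℝ}
    (hp : ∀ k, 0 ≤ p k) (hsum : ∑ k, p k = 1) (hf : ∀ k, 0 < f k) :
    0 < ∑ k, p k * f k := by
  obtain ⟨k, hk, hpk⟩ := Finset.exists_ne_zero_of_sum_ne_zero (hsum.trans_ne one_ne_zero)
  exact Finset.sum_pos' (fun j _ => mul_nonneg (hp j) (hf j).le)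
    ⟨k, hk, mul_pos ((hp k).lt_of_ne' hpk) (hf k)⟩


/-- Local optimality implies ML optimality: let `C ⊆ {0,1}^n` be a (linear, i.e. ⊕-closed)
code, `D` the set of `w`-weighted minimal `T`-local deviations (vectors in `[0,1]^n`), and
suppose `x ∈ C` is locally optimal for `λ`: `⟨λ, x ⊕ β⟩ > ⟨λ, x⟩` for every `β ∈ D`. Assume
the decomposition lemma: every nonzero codeword `z ∈ C` is `α`-proportional, `α ∈ (0,1]`, to
the mean of a (finitely supported) distribution over deviations in `D`. Then `x` is the unique
maximum-likelihood codeword: `⟨λ, x'⟩ > ⟨λ, x⟩` for every codeword `x' ≠ x`.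
Here `(a ⊕ b)_i = |a_i − b_i|` is the relative point. -/
theorem local_optimality_implies_ML
    {n : ℕ} (C : Set (Fin n → ℝ))
    (hCbin : ∀ y ∈ C, ∀ i, y i = 0 ∨ y i = 1)
    (hCzero : (fun _ => (0 : ℝ)) ∈ C)
    (hCclosed : ∀ y ∈ C, ∀ y' ∈ C, (fun i => |y i - y' i|) ∈ C)
    (D : Set (Fin n → ℝ))
    (hD : ∀ β ∈ D, ∀ i, β i ∈ Set.Icc (0 : ℝ) 1)
    (lam : Fin n → ℝ) (x : Fin n → ℝ) (hx : x ∈ C)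
    (hlocal : ∀ β ∈ D, ∑ i, lam i * |x i - β i| > ∑ i, lam i * x i)
    (hdecomp : ∀ z ∈ C, z ≠ (fun _ => (0 : ℝ)) →
      ∃ (m : ℕ) (p : Fin m → ℝ) (β : Fin m → Fin n → ℝ),
        (∀ k, 0 ≤ p k) ∧ (∑ k, p k = 1) ∧ (∀ k, β k ∈ D) ∧
        ∃ α : ℝ, α ∈ Set.Ioc (0 : ℝ) 1 ∧ ∀ i, ∑ k, p k * β k i = α * z i) :
    ∀ x' ∈ C, x' ≠ x → ∑ i, lam i * x' i > ∑ i, lam i * x i := by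
  intro x' hx' hne
  have hxbin := hCbin x hx
  set z : Fin n → ℝ := fun i => |x i - x' i| with hz
  have hzC : z ∈ C := hCclosed x hx x' hx'
  have hz0 : z ≠ fun _ => (0 : ℝ) := fun h =>
    hne (funext fun i => (sub_eq_zero.mp (abs_eq_zero.mp (congrFun h i))).symm)
  have hzIcc : ∀ i, z i ∈ Set.Icc (0 : ℝ) 1 := fun i => by
    rcases hCbin z hzC i with h | h <;> simp [h]
  have hx'_eq : ∀ i, x' i = |x i - z i| := fun i => by
    rcases hxbin i with h | h <;> rcases hCbin x' hx' i with h' | h' <;> simp [hz, h, h']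
  obtain ⟨m, p, β, hp, hsum, hβ, α, hα, hmean⟩ := hdecomp z hzC hz0
  have hpos : ∀ k, 0 < ∑ i, lam i * (1 - 2 * x i) * β k i := fun k => by
    have := hlocal _ (hβ k)
    rw [sum_mul_abs_sub_of_binary lam hxbin (hD _ (hβ k))] at this
    linarith
  have hswap : ∑ k, p k * ∑ i, lam i * (1 - 2 * x i) * β k i =
      α * ∑ i, lam i * (1 - 2 * x i) * z i := by
    simp_rw [Finset.mul_sum]
    rw [Finset.sum_comm]
    refine Finset.sum_congr rfl fun i _ => ?_
    rw [mul_left_comm α, ← hmean i, Finset.mul_sum]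
    exact Finset.sum_congr rfl fun k _ => mul_left_comm _ _ _
  have hzpos := pos_of_mul_pos_right (hswap ▸ sum_mul_pos_of_sum_eq_one hp hsum hpos) hα.1.le
  simp_rw [hx'_eq]
  rw [sum_mul_abs_sub_of_binary lam hxbin hzIcc]
  linarith
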